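/- One has lim_{x→+∞} e^{πx} ψ(x) = 2π, and lim_{x→0⁺} x^{5/2} e^{π/(4x)} ψ(x) = π/2. -/

import Mathlib

open Real Filter

noncomputable def psi (x : ℝ) : ℝ :=
  -2 * π * ∑' n : ℕ, (-1 : ℝ) ^ (n + 1) * ((n : ℝ) + 1) ^ 2 *
      Real.exp (-π * ((n : ℝ) + 1) ^ 2 * x)

/-- The Gaussian sums over shifted integers converge absolutely. -/
lemma summable_exp_neg_mul_int_add_sq (a : ℝ) {δ : ℝ} (hδ : 0 < δ) :
    Summable fun n : ℤ => Real.exp (-(δ * ((n : ℝ) + a) ^ 2)) := by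
  have h := summable_pow_mul_jacobiTheta₂_term_bound (δ / π * |a|) (div_pos hδ pi_pos) 0
  refine Summable.of_nonneg_of_le (fun _ => (Real.exp_pos _).le) (fun n => ?_) h
  rw [pow_zero, one_mul, Real.exp_le_exp]
  have e : -π * (δ / π * (n : ℝ) ^ 2 - 2 * (δ / π * |a|) * |(n : ℝ)|) =
      -(δ * ((n : ℝ) ^ 2 - 2 * (|(n : ℝ)| * |a|))) := by
    field_simp
  push_cast
  rw [e, neg_le_neg_iff]
  have h1 := neg_abs_le ((n : ℝ) * a)
  rw [abs_mul] at h1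
  gcongr
  nlinarith [sq_nonneg a]

lemma mul_exp_neg_mul_le {δ : ℝ} (hδ : 0 < δ) (y : ℝ) :
    y * Real.exp (-(δ * y)) ≤ 2 / δ * Real.exp (-(δ / 2 * y)) := by
  have h := Real.add_one_le_exp (δ / 2 * y)
  have e : Real.exp (-(δ * y)) = Real.exp (-(δ / 2 * y)) * Real.exp (-(δ / 2 * y)) := by
    rw [← Real.exp_add]
    ring_nf
  have h1 : y ≤ 2 / δ * Real.exp (δ / 2 * y) := by
    calc y = 2 / δ * (δ / 2 * y) := by field_simp
      _ ≤ _ := by gcongr; linarith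
  calc y * Real.exp (-(δ * y))
      ≤ 2 / δ * Real.exp (δ / 2 * y) * Real.exp (-(δ * y)) := by gcongr
    _ = 2 / δ * Real.exp (-(δ / 2 * y)) := by
      rw [mul_assoc, ← Real.exp_add]
      ring_nf

lemma summable_mul_exp_neg_mul {ι : Type*} {q : ι → ℝ} (hq : ∀ i, 0 ≤ q i)
    (hs : ∀ δ : ℝ, 0 < δ → Summable fun i => Real.exp (-(δ * q i))) {δ : ℝ} (hδ : 0 < δ) :
    Summable fun i => q i * Real.exp (-(δ * q i)) :=
  Summable.of_nonneg_of_le (fun i => mul_nonneg (hq i) (Real.exp_pos _).le)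
    (fun i => mul_exp_neg_mul_le hδ (q i)) ((hs _ (half_pos hδ)).mul_left (2 / δ))

/-- A sum of exponentials with bounded coefficients may be differentiated termwise. -/
lemma hasDerivAt_tsum_mul_exp_neg_mul {ι : Type*} {c q : ι → ℝ} (hc : ∀ i, |c i| ≤ 1)
    (hq : ∀ i, 0 ≤ q i) (hs : ∀ δ : ℝ, 0 < δ → Summable fun i => Real.exp (-(δ * q i)))
    {t : ℝ} (ht : 0 < t) :
    HasDerivAt (fun s => ∑' i, c i * Real.exp (-(s * q i)))
      (∑' i, -(c i * (q i * Real.exp (-(t * q i))))) t := by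
  have ht2 := half_pos ht
  refine hasDerivAt_tsum_of_isPreconnected (t := Set.Ioi (t / 2)) (y₀ := t)
    (summable_mul_exp_neg_mul hq hs ht2) isOpen_Ioi isPreconnected_Ioi
    (g := fun i s => c i * Real.exp (-(s * q i)))
    (g' := fun i s => -(c i * (q i * Real.exp (-(s * q i))))) ?_ ?_ ?_ ?_ ?_
  · intro i s _
    have h := (((hasDerivAt_id s).mul_const (q i)).neg.exp).const_mul (c i)
    refine h.congr_deriv ?_
    simp only [Pi.neg_apply, id_eq]
    ring
  · intro i s hs'
    rw [norm_neg, norm_mul, Real.norm_eq_abs, Real.norm_eq_abs,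
      abs_of_nonneg (mul_nonneg (hq i) (Real.exp_pos _).le)]
    calc |c i| * (q i * Real.exp (-(s * q i)))
        ≤ 1 * (q i * Real.exp (-(t / 2 * q i))) := by
          have := hq i
          have : t / 2 ≤ s := le_of_lt hs'
          gcongr
          exact hc i
      _ = _ := one_mul _
  · exact half_lt_self ht
  · refine (hs t ht).of_norm_bounded fun i => ?_
    rw [norm_mul, Real.norm_eq_abs, Real.norm_eq_abs, Real.abs_exp]
    exact mul_le_of_le_one_left (Real.exp_pos _).le (hc i)
  · exact half_lt_self ht

/-- As `t → ∞`, only the terms with vanishing exponent survive. -/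
lemma tendsto_tsum_mul_exp_neg_mul {ι : Type*} {c q : ι → ℝ} (hq : ∀ i, 0 ≤ q i)
    (hs : Summable fun i => |c i| * Real.exp (-q i)) :
    Tendsto (fun t : ℝ => ∑' i, c i * Real.exp (-(t * q i))) atTop
      (nhds (∑' i, if q i = 0 then c i else 0)) := by
  refine tendsto_tsum_of_dominated_convergence hs (fun i => ?_) ?_
  · split_ifs with h
    · simp [h]
    · have hpos : 0 < q i := lt_of_le_of_ne (hq i) (Ne.symm h)
      have h1 := (Real.tendsto_exp_neg_atTop_nhds_zero.comp
        (tendsto_id.atTop_mul_const hpos)).const_mul (c i)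
      simpa using h1
  · filter_upwards [eventually_ge_atTop 1] with t ht i
    rw [norm_mul, Real.norm_eq_abs, Real.norm_eq_abs, Real.abs_exp]
    gcongr
    exact le_mul_of_one_le_left (hq i) ht

lemma summable_exp_neg_mul_pi_sq (a : ℝ) (δ : ℝ) (hδ : 0 < δ) :
    Summable fun n : ℤ => Real.exp (-(δ * (π * ((n : ℝ) + a) ^ 2))) := by
  simpa only [mul_assoc] using summable_exp_neg_mul_int_add_sq a (mul_pos hδ pi_pos)

lemma summable_sq_mul_exp_neg_pi_sq (a : ℝ) :
    Summable fun n : ℤ => π * ((n : ℝ) + a) ^ 2 * Real.exp (-(π * ((n : ℝ) + a) ^ 2)) := by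
  simpa using summable_mul_exp_neg_mul (q := fun n : ℤ => π * ((n : ℝ) + a) ^ 2)
    (fun n => by positivity) (summable_exp_neg_mul_pi_sq a) one_pos

lemma tendsto_exp_mul_psi_atTop :
    Tendsto (fun x : ℝ => Real.exp (π * x) * psi x) atTop (nhds (2 * π)) := by
  have h := tendsto_tsum_mul_exp_neg_mul (ι := ℕ)
    (c := fun n => (-1 : ℝ) ^ (n + 1) * ((n : ℝ) + 1) ^ 2)
    (q := fun n => π * (((n : ℝ) + 1) ^ 2 - 1)) (fun n => ?_) ?_
  · have e : (∑' n : ℕ, if π * (((n : ℝ) + 1) ^ 2 - 1) = 0 then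
        (-1 : ℝ) ^ (n + 1) * ((n : ℝ) + 1) ^ 2 else 0) = -1 := by
      rw [tsum_eq_single 0]
      · simp
      · intro n hn
        rw [if_neg]
        have : (0 : ℝ) < n := by positivity
        have : 0 < π * (((n : ℝ) + 1) ^ 2 - 1) := mul_pos pi_pos (by nlinarith)
        exact this.ne'
    rw [e] at h
    convert h.const_mul (-2 * π) using 2
    · rename_i x
      rw [psi, mul_left_comm, ← tsum_mul_left]
      congr 2
      ext n
      rw [mul_left_comm, ← Real.exp_add]
      ring_nf
    · ring
  · have : (0 : ℝ) ≤ n := n.cast_nonneg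
    exact mul_nonneg pi_pos.le (by nlinarith)
  · have hi : Function.Injective fun n : ℕ => (n : ℤ) + 1 := fun a b hab => by
      simpa using hab
    refine (summable_congr fun n => ?_).mpr
      (((summable_sq_mul_exp_neg_pi_sq 0).comp_injective hi).mul_left (Real.exp π / π))
    simp only [Function.comp_apply, abs_mul, abs_pow, abs_neg, abs_one, one_pow, one_mul,
      Int.cast_add, Int.cast_natCast, Int.cast_one, add_zero, sq_abs]
    rw [show -(π * (((n : ℝ) + 1) ^ 2 - 1)) = π + -(π * ((n : ℝ) + 1) ^ 2) by ring, Real.exp_add]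
    field_simp

lemma cosKernel_half_eq_tsum {x : ℝ} (hx : 0 < x) :
    HurwitzZeta.cosKernel ((1 / 2 : ℝ) : UnitAddCircle) x =
      ∑' n : ℤ, (-1 : ℝ) ^ n * Real.exp (-(x * (π * (n : ℝ) ^ 2))) := by
  have h := HurwitzZeta.hasSum_int_cosKernel (1 / 2) hx
  refine (HasSum.tsum_eq ?_).symm
  rw [← Complex.hasSum_ofReal]
  convert h using 2 with n
  rw [show 2 * (π : ℂ) * Complex.I * ((1 / 2 : ℝ) : ℂ) * n = n * (π * Complex.I) by
    push_cast; ring, Complex.exp_int_mul, Complex.exp_pi_mul_I]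
  push_cast
  ring_nf

lemma hasDerivAt_cosKernel_half {x : ℝ} (hx : 0 < x) :
    HasDerivAt (HurwitzZeta.cosKernel ((1 / 2 : ℝ) : UnitAddCircle)) (psi x) x := by
  have h := hasDerivAt_tsum_mul_exp_neg_mul (c := fun n : ℤ => (-1 : ℝ) ^ n)
    (q := fun n : ℤ => π * (n : ℝ) ^ 2) (fun n => by simp [abs_zpow])
    (fun n => by positivity) (fun δ hδ => by simpa using summable_exp_neg_mul_pi_sq 0 δ hδ) hx
  refine (h.congr_of_eventuallyEq ?_).congr_deriv ?_
  · filter_upwards [lt_mem_nhds hx] with y hy using cosKernel_half_eq_tsum hy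
  · have hs := summable_mul_exp_neg_mul (q := fun n : ℤ => π * (n : ℝ) ^ 2)
      (fun n => by positivity) (fun δ hδ => by simpa using summable_exp_neg_mul_pi_sq 0 δ hδ) hx
    have hs' : Summable fun n : ℤ =>
        -((-1 : ℝ) ^ n * (π * (n : ℝ) ^ 2 * Real.exp (-(x * (π * (n : ℝ) ^ 2))))) := by
      refine hs.of_norm_bounded fun n => le_of_eq ?_
      rw [norm_neg, norm_mul, norm_zpow, norm_neg, norm_one, one_zpow, one_mul,
        Real.norm_of_nonneg (by positivity)]
    have heven : Function.Even fun n : ℤ =>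
        -((-1 : ℝ) ^ n * (π * (n : ℝ) ^ 2 * Real.exp (-(x * (π * (n : ℝ) ^ 2))))) := fun n => by
      have h1 : (-1 : ℝ) ^ (-n) = (-1 : ℝ) ^ n := by rw [zpow_neg, ← inv_zpow, inv_neg_one]
      simp only [h1, Int.cast_neg, neg_sq]
    rw [tsum_int_eq_zero_add_two_mul_tsum_pnat heven hs']
    simp only [Int.cast_natCast, zpow_natCast]
    rw [tsum_pnat_eq_tsum_succ (f := fun n : ℕ => -((-1 : ℝ) ^ n *
        (π * (n : ℝ) ^ 2 * Real.exp (-(x * (π * (n : ℝ) ^ 2)))))), psi,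
      tsum_neg, Int.cast_zero, nsmul_eq_mul, neg_mul, neg_mul, mul_assoc 2 π, ← tsum_mul_left]
    norm_num
    congr 1
    ext n
    ring_nf

lemma hasDerivAt_evenKernel_half {t : ℝ} (ht : 0 < t) :
    HasDerivAt (HurwitzZeta.evenKernel ((1 / 2 : ℝ) : UnitAddCircle))
      (-∑' n : ℤ, π * ((n : ℝ) + 1 / 2) ^ 2 *
        Real.exp (-(t * (π * ((n : ℝ) + 1 / 2) ^ 2)))) t := by
  have h := hasDerivAt_tsum_mul_exp_neg_mul (c := fun _ : ℤ => (1 : ℝ))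
    (q := fun n : ℤ => π * ((n : ℝ) + 1 / 2) ^ 2) (fun n => by simp)
    (fun n => by positivity) (summable_exp_neg_mul_pi_sq (1 / 2)) ht
  refine (h.congr_of_eventuallyEq ?_).congr_deriv ?_
  · filter_upwards [lt_mem_nhds ht] with y hy
    rw [← (HurwitzZeta.hasSum_int_evenKernel (1 / 2) hy).tsum_eq]
    congr 1
    ext n
    ring_nf
  · simp only [one_mul, tsum_neg]

lemma tendsto_exp_mul_tsum_half {c : ℤ → ℝ}
    (hc : Summable fun n : ℤ => |c n| * Real.exp (-(π * ((n : ℝ) + 1 / 2) ^ 2))) :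
    Tendsto (fun t : ℝ => Real.exp (π / 4 * t) *
      ∑' n : ℤ, c n * Real.exp (-(t * (π * ((n : ℝ) + 1 / 2) ^ 2)))) atTop
      (nhds (c (-1) + c 0)) := by
  have hfac (n : ℤ) : π * (((n : ℝ) + 1 / 2) ^ 2 - 1 / 4) = π * ((n * (n + 1) : ℤ) : ℝ) := by
    push_cast
    ring
  have h := tendsto_tsum_mul_exp_neg_mul (c := c)
    (q := fun n : ℤ => π * (((n : ℝ) + 1 / 2) ^ 2 - 1 / 4)) (fun n => ?_) ?_
  · have e : (∑' n : ℤ, if π * (((n : ℝ) + 1 / 2) ^ 2 - 1 / 4) = 0 then c n else 0) =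
        c (-1) + c 0 := by
      rw [tsum_eq_sum (s := {-1, 0})]
      · rw [Finset.sum_pair (by norm_num)]
        norm_num
      · intro n hn
        rw [if_neg]
        rw [hfac]
        simp only [Finset.mem_insert, Finset.mem_singleton, not_or] at hn
        refine mul_ne_zero pi_ne_zero (Int.cast_ne_zero.mpr (mul_ne_zero hn.2 ?_))
        omega
    rw [e] at h
    convert h using 2 with t
    rw [← tsum_mul_left]
    congr 1
    ext n
    rw [mul_left_comm, ← Real.exp_add]
    ring_nf
  · rw [hfac]
    refine mul_nonneg pi_pos.le (Int.cast_nonneg ?_)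
    rcases le_or_gt 0 n with hn | hn
    · positivity
    · exact mul_nonneg_of_nonpos_of_nonpos hn.le hn
  · refine (summable_congr fun n => ?_).mpr (hc.mul_left (Real.exp (π / 4)))
    rw [mul_left_comm, ← Real.exp_add]
    ring_nf

lemma psi_eq_evenKernel {x : ℝ} (hx : 0 < x) :
    x ^ ((5 : ℝ) / 2) * psi x =
      -(x / 2) * HurwitzZeta.evenKernel ((1 / 2 : ℝ) : UnitAddCircle) x⁻¹ +
      ∑' n : ℤ, π * ((n : ℝ) + 1 / 2) ^ 2 *
        Real.exp (-(x⁻¹ * (π * ((n : ℝ) + 1 / 2) ^ 2))) := by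
  have hd := (hasDerivAt_rpow_const (p := -(1 / 2 : ℝ)) (Or.inl hx.ne')).mul
    ((hasDerivAt_evenKernel_half (inv_pos.mpr hx)).comp x (hasDerivAt_inv hx.ne'))
  have hc := (hasDerivAt_cosKernel_half hx).congr_of_eventuallyEq
    (f₁ := (fun y : ℝ => y ^ (-(1 / 2 : ℝ))) *
      (HurwitzZeta.evenKernel ((1 / 2 : ℝ) : UnitAddCircle) ∘ fun y => y⁻¹)) (by
      filter_upwards [lt_mem_nhds hx] with y hy
      have hy' : (0 : ℝ) < y ^ (1 / 2 : ℝ) := rpow_pos_of_pos hy _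
      simp only [Pi.mul_apply, Function.comp_apply]
      rw [HurwitzZeta.evenKernel_functional_equation, inv_rpow hy.le, rpow_neg hy.le,
        one_div y⁻¹, inv_inv]
      field_simp)
  rw [hc.unique hd, Function.comp_apply, mul_add]
  have e1 : x ^ ((5 : ℝ) / 2) * x ^ (-(1 / 2 : ℝ) - 1) = x := by
    rw [← rpow_add hx]
    norm_num
  have e2 : x ^ ((5 : ℝ) / 2) * x ^ (-(1 / 2 : ℝ)) = x ^ 2 := by
    rw [← rpow_add hx, ← rpow_natCast]
    norm_num
  congr 1
  · linear_combination (-(1 / 2) *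
      HurwitzZeta.evenKernel ((1 / 2 : ℝ) : UnitAddCircle) x⁻¹) * e1
  · rw [← mul_assoc, e2, neg_mul_neg, mul_comm, mul_assoc, inv_mul_cancel₀ (by positivity),
      mul_one]

theorem statement2 :
    Tendsto (fun x : ℝ => Real.exp (π * x) * psi x) atTop (nhds (2 * π)) ∧
    Tendsto (fun x : ℝ => x ^ ((5 : ℝ) / 2) * Real.exp (π / (4 * x)) * psi x)
      (nhdsWithin 0 (Set.Ioi 0)) (nhds (π / 2)) := by
  refine ⟨tendsto_exp_mul_psi_atTop, ?_⟩
  have h0 := (tendsto_exp_mul_tsum_half (c := fun _ => 1)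
    (by simpa using summable_exp_neg_mul_pi_sq (1 / 2) 1 one_pos)).comp
    tendsto_inv_nhdsGT_zero
  have h1 := (tendsto_exp_mul_tsum_half (c := fun n => π * ((n : ℝ) + 1 / 2) ^ 2) (by
    convert summable_sq_mul_exp_neg_pi_sq (1 / 2) using 3
    exact abs_of_nonneg (by positivity))).comp tendsto_inv_nhdsGT_zero
  have hx : Tendsto (fun x : ℝ => -(x / 2)) (nhdsWithin 0 (Set.Ioi 0)) (nhds 0) := by
    have : Tendsto (fun x : ℝ => -(x / 2)) (nhds 0) (nhds (-(0 / 2))) :=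
      (tendsto_id.div_const 2).neg
    simpa using this.mono_left nhdsWithin_le_nhds
  have h := (hx.mul h0).add h1
  refine (h.congr' ?_).trans_eq ?_
  · filter_upwards [self_mem_nhdsWithin] with x hx
    have hx : 0 < x := hx
    have hE : HurwitzZeta.evenKernel ((1 / 2 : ℝ) : UnitAddCircle) x⁻¹ =
        ∑' n : ℤ, 1 * Real.exp (-(x⁻¹ * (π * ((n : ℝ) + 1 / 2) ^ 2))) := by
      rw [← (HurwitzZeta.hasSum_int_evenKernel (1 / 2) (inv_pos.mpr hx)).tsum_eq]
      congr 1
      ext n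
      ring_nf
    have he : π / (4 * x) = π / 4 * x⁻¹ := by field_simp
    rw [mul_right_comm, psi_eq_evenKernel hx, hE, he]
    simp only [Function.comp_apply]
    ring
  · congr 1
    push_cast
    ring
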